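/- Let T be a tree with vertex set V, let a group Γ act on T by graph automorphisms, let s be an H-segment in T (equivalently, an oriented geodesic segment), and let n ≥ 1. Let κ : V^{n+1} → ℝ be bounded, Γ-invariant, and satisfy δκ = 0. Then there exists a bounded Γ-invariant function β : V^{n+2} → ℝ such that δβ = (δ¹f_s) ∪ κ as functions V^{n+3} → ℝ; that is, for every ζ in the degree-n Γ-equivariant bounded cohomology of T, the cup product [δ¹f_s] ∪ ζ is trivial. -/

import Mathlib

open scoped BigOperators

namespace MedianQM

variable {V : Type*}

/-- The interval `[x,y]`: vertices on geodesics from `x` to `y`. -/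
def interval (X : SimpleGraph V) (x y : V) : Set V :=
  {m | X.dist x m + X.dist m y = X.dist x y}

/-- A median graph: connected, and any three vertices admit a unique median. -/
def IsMedianGraph (X : SimpleGraph V) : Prop :=
  X.Connected ∧ ∀ x y z : V, ∃! m : V,
    m ∈ interval X x y ∧ m ∈ interval X y z ∧ m ∈ interval X x z

/-- A halfspace of `X`: the set of vertices strictly closer to one endpoint of
an edge than to the other. -/
def IsHalfspace (X : SimpleGraph V) (h : Set V) : Prop :=
  ∃ a b : V, X.Adj a b ∧ h = {v | X.dist v a < X.dist v b}

/-- The edge `{a,b}` is dual to the halfspace `h` (equivalently, to the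
hyperplane `{h, h̄}`). -/
def EdgeDual (X : SimpleGraph V) (h : Set V) (a b : V) : Prop :=
  X.Adj a b ∧
    (h = {v | X.dist v a < X.dist v b} ∨ h = {v | X.dist v b < X.dist v a})

/-- Two halfspaces are transverse. -/
def Transv (h k : Set V) : Prop :=
  (h ∩ k).Nonempty ∧ (hᶜ ∩ k).Nonempty ∧ (h ∩ kᶜ).Nonempty ∧ (hᶜ ∩ kᶜ).Nonempty

/-- `[x,y]_H`: the set of halfspaces separating `y` from `x`. -/
def sepH (X : SimpleGraph V) (x y : V) : Set (Set V) :=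
  {h | IsHalfspace X h ∧ y ∈ h ∧ x ∉ h}

/-- `X` has dimension at most `D`: every (finite) family of pairwise transverse
halfspaces has at most `D` elements. -/
def DimLE (X : SimpleGraph V) (D : ℕ) : Prop :=
  ∀ S : Finset (Set V), (∀ h ∈ S, IsHalfspace X h) →
    (∀ h ∈ S, ∀ k ∈ S, h ≠ k → Transv h k) → S.card ≤ D

/-- `h ⊋ k` are tightly nested: no halfspace lies strictly between them. -/
def TightlyNested (X : SimpleGraph V) (h k : Set V) : Prop :=
  k ⊂ h ∧ ¬ ∃ h' : Set V, IsHalfspace X h' ∧ h' ⊂ h ∧ k ⊂ h'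

/-- A staircase of length `n`. -/
def IsStaircase (X : SimpleGraph V) (n : ℕ) (h k : Fin n → Set V) : Prop :=
  (∀ i, IsHalfspace X (h i)) ∧ (∀ i, IsHalfspace X (k i)) ∧
  (∀ i j : Fin n, i < j → h j ⊂ h i) ∧ (∀ i j : Fin n, i < j → k j ⊂ k i) ∧
  (∀ i, k i ⊂ h i) ∧ (∀ i j : Fin n, j < i → Transv (h i) (k j))

/-- `X` has staircase length at most `σ`: there is no staircase of length `σ+1`. -/
def StaircaseLE (X : SimpleGraph V) (σ : ℕ) : Prop :=
  ∀ h k : Fin (σ + 1) → Set V, ¬ IsStaircase X (σ + 1) h k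

/-- An `H`-segment of length `l`: a tuple of consecutively tightly nested
halfspaces `h₁ ⊋ ⋯ ⊋ h_l`. -/
def IsHSegment (X : SimpleGraph V) (l : ℕ) (s : Fin l → Set V) : Prop :=
  (∀ i, IsHalfspace X (s i)) ∧
  ∀ i j : Fin l, (j : ℕ) = (i : ℕ) + 1 → TightlyNested X (s i) (s j)

/-- The segment `t` is contained in `[x,y]_H`. -/
def SegIn (X : SimpleGraph V) (x y : V) {l : ℕ} (t : Fin l → Set V) : Prop :=
  ∀ i, t i ∈ sepH X x y

/-- The translate of a segment by a group element. -/
def segSMul {Γ : Type*} [SMul Γ V] (γ : Γ) {l : ℕ} (s : Fin l → Set V) :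
    Fin l → Set V :=
  fun i => (γ • ·) '' s i

/-- The set of translates of `s` contained in `[x,y]_H`. -/
def translatesIn (X : SimpleGraph V) (Γ : Type*) [SMul Γ V] {l : ℕ}
    (s : Fin l → Set V) (x y : V) : Set (Fin l → Set V) :=
  {t | (∃ γ : Γ, t = segSMul γ s) ∧ SegIn X x y t}

/-- The median quasimorphism of the segment `s` (for the action of `Γ` on `X`). -/
noncomputable def fs (X : SimpleGraph V) (Γ : Type*) [SMul Γ V] {l : ℕ}
    (s : Fin l → Set V) (x y : V) : ℝ :=
  ((translatesIn X Γ s x y).ncard : ℝ) - ((translatesIn X Γ s y x).ncard : ℝ)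

/-- The coboundary of a function of two variables, evaluated on a triple. -/
noncomputable def d1 (f : V → V → ℝ) (x y z : V) : ℝ := f y z - f x z + f x y

/-- The simplicial coboundary operator. -/
noncomputable def cob {W : Type*} {m : ℕ} (β : (Fin (m + 1) → W) → ℝ) :
    (Fin (m + 2) → W) → ℝ :=
  fun x => ∑ j : Fin (m + 2), (-1 : ℝ) ^ (j : ℕ) * β (fun i => x (j.succAbove i))

/-- Γ-invariance of a cochain. -/
def IsInvariant (Γ : Type*) {W : Type*} [SMul Γ W] {m : ℕ}
    (β : (Fin m → W) → ℝ) : Prop :=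
  ∀ (γ : Γ) (x : Fin m → W), β (fun i => γ • x i) = β x

/-- Boundedness of a real-valued function. -/
def IsBounded {α : Type*} (β : α → ℝ) : Prop := ∃ C : ℝ, ∀ x, |β x| ≤ C

/-- A head of the segment `s`. -/
def IsHead (X : SimpleGraph V) {l : ℕ} (hl : 0 < l) (s : Fin l → Set V)
    (a : V) : Prop :=
  a ∉ s ⟨0, hl⟩ ∧ ∃ b, EdgeDual X (s ⟨0, hl⟩) a b

/-- A tail of the segment `s`. -/
def IsTail (X : SimpleGraph V) {l : ℕ} (hl : 0 < l) (s : Fin l → Set V)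
    (a : V) : Prop :=
  a ∈ s ⟨l - 1, by omega⟩ ∧ ∃ b, EdgeDual X (s ⟨l - 1, by omega⟩) a b

/-- The cochain `κ` is non-transverse to the segment `s`. -/
def NonTransverseTo (X : SimpleGraph V) {n l : ℕ} (hl : 0 < l)
    (κ : (Fin (n + 1) → V) → ℝ) (s : Fin l → Set V) : Prop :=
  (∀ (x : Fin n → V) (a a' : V), IsHead X hl s a → IsHead X hl s a' →
    κ (Fin.cons a x) = κ (Fin.cons a' x)) ∧
  (∀ (x : Fin n → V) (a a' : V), IsTail X hl s a → IsTail X hl s a' →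
    κ (Fin.cons a x) = κ (Fin.cons a' x))

/-- The action of `Γ` on `X` is by graph automorphisms. -/
def ActsOn (Γ : Type*) [SMul Γ V] (X : SimpleGraph V) : Prop :=
  ∀ (γ : Γ) (a b : V), X.Adj a b → X.Adj (γ • a) (γ • b)

/-- A predicate that is constant along the edges of the set of vertices closer to `a` than to `b`
is constant on that set; `r` is `<` or `≤`. -/
theorem halfspace_induction {X : SimpleGraph V} (hX : X.Connected) {a b : V} (r : ℕ → ℕ → Prop)
    (hr : ∀ i j k : ℕ, r (i + 1) j → j ≤ k + 1 → r i k) {P : V → Prop} (ha : P a)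
    (hP : ∀ u v, X.Adj u v → r (X.dist u a) (X.dist u b) → r (X.dist v a) (X.dist v b) →
      P u → P v) (w : V) (hw : r (X.dist w a) (X.dist w b)) : P w := by
  induction hd : X.dist w a generalizing w with
  | zero => rwa [(hX.dist_eq_zero_iff).1 hd]
  | succ d ih =>
    obtain ⟨p, hp⟩ := hX.exists_walk_length_eq_dist w a
    cases p with
    | nil => simp_all
    | @cons _ w' _ h q =>
      have h1 : X.dist w' a = d := by
        have h2 := SimpleGraph.dist_le q
        have h3 := hX.dist_triangle (u := w) (v := w') (w := a)
        rw [SimpleGraph.dist_eq_one_iff_adj.2 h] at h3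
        simp only [SimpleGraph.Walk.length_cons] at hp
        omega
      have h4 := hX.dist_triangle (u := w) (v := w') (w := b)
      rw [SimpleGraph.dist_eq_one_iff_adj.2 h] at h4
      have hw' : r (X.dist w' a) (X.dist w' b) := by
        rw [hd] at hw
        rw [h1]
        exact hr _ _ _ hw (by omega)
      exact hP w' w h.symm hw' hw (ih w' hw' h1)

/-- In a tree, a halfspace is crossed by a unique edge. -/
theorem eq_of_mem_of_notMem {T : SimpleGraph V} (hT : T.IsTree) {a b u v : V} (hab : T.Adj a b)
    (huv : T.Adj u v) (hu : T.dist u a < T.dist u b) (hv : ¬ T.dist v a < T.dist v b) :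
    u = a ∧ v = b := by
  have hC : T.Connected := hT.connected
  have hb : T.IsBridge s(a, b) := SimpleGraph.isAcyclic_iff_forall_adj_isBridge.1 hT.isAcyclic hab
  rw [SimpleGraph.isBridge_iff] at hb
  have hab1 := SimpleGraph.dist_eq_one_iff_adj.2 hab
  have hba1 := SimpleGraph.dist_eq_one_iff_adj.2 hab.symm
  have h1 : (T.deleteEdges {s(a, b)}).Reachable a u := by
    refine halfspace_induction hC (a := a) (b := b) (· < ·) (by intros; omega)
      (P := fun w => (T.deleteEdges {s(a, b)}).Reachable a w)
      (SimpleGraph.Reachable.refl _) ?_ u hu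
    intro p q hpq hp hq hr
    refine hr.trans (SimpleGraph.Adj.reachable ?_)
    rw [SimpleGraph.deleteEdges_adj]
    refine ⟨hpq, ?_⟩
    simp only [Set.mem_singleton_iff, Sym2.eq_iff]
    rintro (⟨rfl, rfl⟩ | ⟨rfl, rfl⟩) <;> simp_all
  have h2 : (T.deleteEdges {s(a, b)}).Reachable b v := by
    refine halfspace_induction hC (a := b) (b := a) (· ≤ ·) (by intros; omega)
      (P := fun w => (T.deleteEdges {s(a, b)}).Reachable b w)
      (SimpleGraph.Reachable.refl _) ?_ v (by omega)
    intro p q hpq hp hq hr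
    refine hr.trans (SimpleGraph.Adj.reachable ?_)
    rw [SimpleGraph.deleteEdges_adj]
    refine ⟨hpq, ?_⟩
    simp only [Set.mem_singleton_iff, Sym2.eq_iff]
    rintro (⟨rfl, rfl⟩ | ⟨rfl, rfl⟩)
    · exact hb hr.symm
    · rw [SimpleGraph.dist_self] at hq
      omega
  by_contra hne
  apply hb
  refine h1.trans (SimpleGraph.Reachable.trans (SimpleGraph.Adj.reachable ?_) h2.symm)
  rw [SimpleGraph.deleteEdges_adj]
  refine ⟨huv, ?_⟩
  simp only [Set.mem_singleton_iff, Sym2.eq_iff]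
  rintro (h | ⟨rfl, rfl⟩)
  · exact hne h
  · simp_all

/-- In a tree, the halfspaces separating two given vertices form a chain. -/
theorem sepH_chain {T : SimpleGraph V} (hT : T.IsTree) {x y : V} {h k : Set V}
    (hh : h ∈ sepH T x y) (hk : k ∈ sepH T x y) : h ⊆ k ∨ k ⊆ h := by
  obtain ⟨⟨a, b, hab, rfl⟩, hyh, hxh⟩ := hh
  obtain ⟨⟨c, d, hcd, rfl⟩, hyk, hxk⟩ := hk
  have hC : T.Connected := hT.connected
  by_contra hcon
  rw [not_or, Set.not_subset, Set.not_subset] at hcon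
  obtain ⟨⟨p, hp1, hp2⟩, ⟨q, hq1, hq2⟩⟩ := hcon
  simp only [Set.mem_ofPred_eq] at *
  by_cases hs : T.dist c a < T.dist c b ↔ T.dist d a < T.dist d b
  · by_cases hc : T.dist c a < T.dist c b
    · have key : ∀ w, T.dist w b ≤ T.dist w a →
          (T.dist w c < T.dist w d ↔ T.dist b c < T.dist b d) := by
        refine halfspace_induction hC (· ≤ ·) (by intros; omega) Iff.rfl ?_
        intro u v huv hu hv ih
        rw [← ih]
        by_contra hne
        by_cases hu' : T.dist u c < T.dist u d
        · have := eq_of_mem_of_notMem hT hcd huv hu' (by tauto)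
          obtain ⟨rfl, rfl⟩ := this
          omega
        · have := eq_of_mem_of_notMem hT hcd huv.symm (by tauto) hu'
          obtain ⟨rfl, rfl⟩ := this
          omega
      have h1 := key x (by omega)
      have h2 := key q (by omega)
      tauto
    · have key : ∀ w, T.dist w a < T.dist w b →
          (T.dist w c < T.dist w d ↔ T.dist a c < T.dist a d) := by
        refine halfspace_induction hC (· < ·) (by intros; omega) Iff.rfl ?_
        intro u v huv hu hv ih
        rw [← ih]
        by_contra hne
        by_cases hu' : T.dist u c < T.dist u d
        · have := eq_of_mem_of_notMem hT hcd huv hu' (by tauto)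
          obtain ⟨rfl, rfl⟩ := this
          omega
        · have := eq_of_mem_of_notMem hT hcd huv.symm (by tauto) hu'
          obtain ⟨rfl, rfl⟩ := this
          omega
      have h1 := key y hyh
      have h2 := key p hp1
      tauto
  · by_cases hc : T.dist c a < T.dist c b
    · obtain ⟨rfl, rfl⟩ := eq_of_mem_of_notMem hT hab hcd hc (by tauto)
      tauto
    · obtain ⟨rfl, rfl⟩ := eq_of_mem_of_notMem hT hab hcd.symm (by tauto) hc
      omega

/-- In a tree, only finitely many halfspaces separate two given vertices. -/
theorem sepH_finite {T : SimpleGraph V} (hT : T.IsTree) (x y : V) : (sepH T x y).Finite := by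
  obtain ⟨p⟩ := hT.connected.preconnected x y
  induction p with
  | nil => exact (Set.finite_empty).subset fun h hh => (hh.2.2 hh.2.1).elim
  | @cons u v w huv q ih =>
    refine ((Set.finite_singleton {z | T.dist z v < T.dist z u}).union ih).subset ?_
    intro h hh
    by_cases hv : v ∈ h
    · left
      obtain ⟨⟨a, b, hab, rfl⟩, -, hu⟩ := hh
      obtain ⟨rfl, rfl⟩ := eq_of_mem_of_notMem hT hab huv.symm hv hu
      rfl
    · exact Or.inr ⟨hh.1, hh.2.1, hv⟩

/-- An `H`-segment in `[x,y]_H` is determined by the position at which a vertex leaves it. -/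
theorem eq_of_splitting {T : SimpleGraph V} (hT : T.IsTree) {l : ℕ} {t t' : Fin l → Set V}
    (ht : IsHSegment T l t) (ht' : IsHSegment T l t') {x y z : V} (hs : SegIn T x y t)
    (hs' : SegIn T x y t') (i j : Fin l) (hij : (j : ℕ) = (i : ℕ) + 1) (hi : z ∈ t i)
    (hj : z ∉ t j) (hi' : z ∈ t' i) (hj' : z ∉ t' j) : t = t' := by
  have key : ∀ r r' : Fin l → Set V, IsHSegment T l r → SegIn T x y r → SegIn T x y r' →
      z ∉ r j → z ∈ r' i → ¬ r' i ⊂ r i := by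
    intro r r' hr hrs hrs' hrj hri' hlt
    refine (hr.2 i j hij).2 ⟨r' i, (hrs' i).1, hlt, ?_⟩
    rcases sepH_chain hT (hrs j) (hrs' i) with h | h
    · exact h.ssubset_of_ne (by rintro h; exact hrj (h ▸ hri'))
    · exact absurd (h hri') hrj
  have h0 : t i = t' i := by
    rcases sepH_chain hT (hs i) (hs' i) with h | h
    · by_contra hne
      exact key t' t ht' hs' hs hj' hi (h.ssubset_of_ne hne)
    · by_contra hne
      exact key t t' ht hs hs' hj hi' (h.ssubset_of_ne (Ne.symm hne))
  have up : ∀ m : ℕ, ∀ hm : (i : ℕ) + m < l, t ⟨i + m, hm⟩ = t' ⟨i + m, hm⟩ := by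
    intro m
    induction m with
    | zero => intro _; exact h0
    | succ m ih =>
      intro hm
      have e := ih (by omega)
      have h1 := ht.2 ⟨i + m, by omega⟩ ⟨i + (m + 1), hm⟩ rfl
      have h2 := ht'.2 ⟨i + m, by omega⟩ ⟨i + (m + 1), hm⟩ rfl
      by_contra hne
      rcases sepH_chain hT (hs ⟨i + (m + 1), hm⟩) (hs' ⟨i + (m + 1), hm⟩) with h | h
      · exact h1.2 ⟨_, (hs' _).1, e ▸ h2.1, h.ssubset_of_ne hne⟩
      · exact h2.2 ⟨_, (hs _).1, e ▸ h1.1, h.ssubset_of_ne (Ne.symm hne)⟩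
  have down : ∀ m : ℕ, ∀ hm : m ≤ (i : ℕ), t ⟨i - m, by omega⟩ = t' ⟨i - m, by omega⟩ := by
    intro m
    induction m with
    | zero => intro _; exact h0
    | succ m ih =>
      intro hm
      have e := ih (by omega)
      have h1 := ht.2 ⟨i - (m + 1), by omega⟩ ⟨i - m, by omega⟩ (by simp only; omega)
      have h2 := ht'.2 ⟨i - (m + 1), by omega⟩ ⟨i - m, by omega⟩ (by simp only; omega)
      by_contra hne
      rcases sepH_chain hT (hs ⟨i - (m + 1), by omega⟩) (hs' ⟨i - (m + 1), by omega⟩) with h | h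
      · exact h2.2 ⟨_, (hs _).1, h.ssubset_of_ne hne, e ▸ h1.1⟩
      · exact h1.2 ⟨_, (hs' _).1, h.ssubset_of_ne (Ne.symm hne), e ▸ h2.1⟩
  funext m
  rcases le_total (i : ℕ) m with h | h
  · have := up (m - i) (by omega)
    simpa only [Nat.add_sub_cancel' h] using this
  · have := down (i - m) (by omega)
    simpa only [Nat.sub_sub_self h] using this

/-- A vertex in some but not all members of an `H`-segment leaves it at some position. -/
theorem exists_splitting {X : SimpleGraph V} {l : ℕ} {t : Fin l → Set V}
    (ht : IsHSegment X l t) {z : V} (hin : ∃ i, z ∈ t i) (hout : ∃ i, z ∉ t i) :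
    ∃ i j : Fin l, (j : ℕ) = (i : ℕ) + 1 ∧ z ∈ t i ∧ z ∉ t j := by
  by_contra! hcon
  obtain ⟨i, hi⟩ := hin
  obtain ⟨j, hj⟩ := hout
  have up : ∀ m : ℕ, ∀ hm : (i : ℕ) + m < l, z ∈ t ⟨i + m, hm⟩ := by
    intro m
    induction m with
    | zero => intro _; exact hi
    | succ m ih => intro hm; exact hcon _ _ rfl (ih (by omega))
  have down : ∀ m : ℕ, ∀ hm : m ≤ (i : ℕ), z ∈ t ⟨i - m, by omega⟩ := by
    intro m
    induction m with
    | zero => intro _; exact hi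
    | succ m ih =>
      intro hm
      exact (ht.2 ⟨i - (m + 1), by omega⟩ ⟨i - m, by omega⟩ (by simp only; omega)).1.subset
        (ih (by omega))
  rcases le_total (i : ℕ) j with h | h
  · have := up (j - i) (by omega)
    simp only [Nat.add_sub_cancel' h] at this
    exact hj this
  · have := down (i - j) (by omega)
    simp only [Nat.sub_sub_self h] at this
    exact hj this

/-- The simplicial coboundary operator, including on functions of the empty tuple. -/
noncomputable def augCob {W : Type*} {m : ℕ} (β : (Fin m → W) → ℝ) : (Fin (m + 1) → W) → ℝ :=
  fun x => ∑ j : Fin (m + 1), (-1 : ℝ) ^ (j : ℕ) * β (fun i => x (j.succAbove i))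

theorem cob_eq_augCob {W : Type*} {m : ℕ} (β : (Fin (m + 1) → W) → ℝ) : cob β = augCob β := rfl

theorem augCob_cons {W : Type*} {m : ℕ} (β : (Fin (m + 1) → W) → ℝ) (a : W)
    (y : Fin (m + 1) → W) :
    augCob β (Fin.cons a y) = β y - augCob (fun z => β (Fin.cons a z)) y := by
  unfold augCob
  rw [Fin.sum_univ_succ]
  have h : ∀ j : Fin (m + 1),
      (fun i => (Fin.cons a y : Fin (m + 2) → W) (j.succ.succAbove i)) =
        Fin.cons a (fun i => y (j.succAbove i)) := by
    intro j
    funext i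
    refine Fin.cases ?_ (fun i => ?_) i <;> simp
  simp only [h, Fin.val_zero, pow_zero, one_mul, Fin.zero_succAbove, Fin.cons_succ, Fin.val_succ,
    pow_succ, mul_neg, mul_one, neg_mul, Finset.sum_neg_distrib]
  rfl

theorem augCob_add {W : Type*} {m : ℕ} (β β' : (Fin m → W) → ℝ) (x : Fin (m + 1) → W) :
    augCob (fun z => β z + β' z) x = augCob β x + augCob β' x := by
  simp only [augCob, mul_add, Finset.sum_add_distrib]

theorem augCob_sub {W : Type*} {m : ℕ} (β β' : (Fin m → W) → ℝ) (x : Fin (m + 1) → W) :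
    augCob (fun z => β z - β' z) x = augCob β x - augCob β' x := by
  simp only [augCob, mul_sub, Finset.sum_sub_distrib]

theorem augCob_const_mul {W : Type*} {m : ℕ} (c : ℝ) (β : (Fin m → W) → ℝ)
    (x : Fin (m + 1) → W) : augCob (fun z => c * β z) x = c * augCob β x := by
  simp only [augCob, Finset.mul_sum]
  exact Finset.sum_congr rfl fun _ _ => by ring

theorem augCob_sum {W ι : Type*} {m : ℕ} (S : Finset ι) (β : ι → (Fin m → W) → ℝ)
    (x : Fin (m + 1) → W) :
    augCob (fun z => ∑ t ∈ S, β t z) x = ∑ t ∈ S, augCob (β t) x := by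
  simp only [augCob, Finset.mul_sum]
  exact Finset.sum_comm

theorem exists_eq_cons {W : Type*} {m : ℕ} (x : Fin (m + 1) → W) :
    ∃ (a : W) (y : Fin m → W), x = Fin.cons a y :=
  ⟨x 0, Fin.tail x, (Fin.cons_self_tail x).symm⟩

theorem augCob_augCob {W : Type*} {m : ℕ} (β : (Fin m → W) → ℝ) (x : Fin (m + 2) → W) :
    augCob (augCob β) x = 0 := by
  induction m with
  | zero => simp [augCob, Fin.sum_univ_succ, Subsingleton.elim _ (default : Fin 0 → W)]
  | succ m ih =>
    obtain ⟨a, y, rfl⟩ := exists_eq_cons x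
    rw [augCob_cons]
    simp only [augCob_cons]
    rw [augCob_sub, ih]
    simp

/-- The cocycle identity, with the first three variables separated. -/
theorem augCob_cons_of_cocycle {W : Type*} {m : ℕ} {κ : (Fin (m + 2) → W) → ℝ}
    (hκ : ∀ x, augCob κ x = 0) (a b c : W) (y : Fin m → W) :
    augCob (fun z => κ (Fin.cons a (Fin.cons b z))) (Fin.cons c y) =
      κ (Fin.cons a (Fin.cons c y)) - κ (Fin.cons b (Fin.cons c y)) := by
  have h := hκ (Fin.cons a (Fin.cons b (Fin.cons c y)))
  rw [augCob_cons, augCob_cons] at h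
  linarith

/-- The Leibniz rule for the cup product of a `1`-cochain with a cocycle. -/
theorem augCob_cup {W : Type*} {m : ℕ} {κ : (Fin (m + 1) → W) → ℝ} (hκ : ∀ x, augCob κ x = 0)
    (f : W → W → ℝ) (a b c : W) (y : Fin m → W) :
    augCob (fun x : Fin (m + 2) → W => f (x 0) (x 1) * κ (Fin.tail x))
        (Fin.cons a (Fin.cons b (Fin.cons c y))) =
      d1 f a b c * κ (Fin.cons c y) := by
  have h := hκ (Fin.cons b (Fin.cons c y))
  rw [augCob_cons] at h
  rw [augCob_cons]
  simp only [Fin.cons_zero, Fin.cons_one, Fin.tail_cons]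
  rw [augCob_cons]
  simp only [Fin.cons_zero, augCob_const_mul]
  unfold d1
  linear_combination -(f a b) * h

theorem augCob_invariant {Γ W : Type*} [SMul Γ W] {m : ℕ} {β : (Fin m → W) → ℝ}
    (hβ : IsInvariant Γ β) : IsInvariant Γ (augCob β) := by
  intro γ x
  unfold augCob
  exact Finset.sum_congr rfl fun j _ => by rw [← hβ γ fun i => x (j.succAbove i)]

/-- The signed indicator counted by the median quasimorphism. -/
noncomputable def segSign (X : SimpleGraph V) (Γ : Type*) [SMul Γ V] {l : ℕ}
    (s : Fin l → Set V) (x y : V) (t : Fin l → Set V) : ℝ :=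
  (translatesIn X Γ s x y).indicator 1 t - (translatesIn X Γ s y x).indicator 1 t

/-- The median quasimorphism with each translate weighted by `w`. -/
noncomputable def weightedFs (X : SimpleGraph V) (Γ : Type*) [SMul Γ V] {l : ℕ}
    (s : Fin l → Set V) (w : (Fin l → Set V) → ℝ) (x y : V) : ℝ :=
  ∑ᶠ t, w t * segSign X Γ s x y t

theorem translatesIn_finite {T : SimpleGraph V} (hT : T.IsTree) (Γ : Type*) [SMul Γ V] {l : ℕ}
    (s : Fin l → Set V) (x y : V) : (translatesIn T Γ s x y).Finite :=
  (Set.Finite.pi' fun _ : Fin l => sepH_finite hT x y).subset fun _ ht => ht.2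

theorem weightedFs_eq_sum (X : SimpleGraph V) (Γ : Type*) [SMul Γ V] {l : ℕ}
    (s : Fin l → Set V) (w : (Fin l → Set V) → ℝ) {x y : V} {S : Finset (Fin l → Set V)}
    (hxy : translatesIn X Γ s x y ⊆ S) (hyx : translatesIn X Γ s y x ⊆ S) :
    weightedFs X Γ s w x y = ∑ t ∈ S, w t * segSign X Γ s x y t := by
  refine finsum_eq_sum_of_support_subset _ fun t ht => ?_
  by_contra h
  refine ht ?_
  simp only [segSign]
  rw [Set.indicator_of_notMem fun h' => h (hxy h'), Set.indicator_of_notMem fun h' => h (hyx h')]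
  simp

theorem exists_weightedFs_eq_sum {T : SimpleGraph V} (hT : T.IsTree) (Γ : Type*) [SMul Γ V]
    {l : ℕ} (s : Fin l → Set V) (x y : V) :
    ∃ S : Finset (Fin l → Set V), ∀ w : (Fin l → Set V) → ℝ,
      weightedFs T Γ s w x y = ∑ t ∈ S, w t * segSign T Γ s x y t := by
  classical
  refine ⟨(translatesIn_finite hT Γ s x y).toFinset ∪ (translatesIn_finite hT Γ s y x).toFinset,
    fun w => weightedFs_eq_sum T Γ s w ?_ ?_⟩ <;> intro t ht <;> simp [ht]

theorem fs_eq_weightedFs {T : SimpleGraph V} (hT : T.IsTree) (Γ : Type*) [SMul Γ V] {l : ℕ}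
    (s : Fin l → Set V) (x y : V) : fs T Γ s x y = weightedFs T Γ s 1 x y := by
  classical
  have h1 := translatesIn_finite hT Γ s x y
  have h2 := translatesIn_finite hT Γ s y x
  rw [weightedFs_eq_sum T Γ s 1 (S := h1.toFinset ∪ h2.toFinset)
    (by intro t ht; simp [ht]) (by intro t ht; simp [ht])]
  simp only [segSign, Pi.one_apply, one_mul, Finset.sum_sub_distrib, fs]
  have key : ∀ {A : Set (Fin l → Set V)} (hA : A.Finite) (S : Finset (Fin l → Set V)),
      hA.toFinset ⊆ S → (A.ncard : ℝ) = ∑ t ∈ S, A.indicator (1 : (Fin l → Set V) → ℝ) t := by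
    intro A hA S hS
    have := Finset.sum_indicator_subset (1 : (Fin l → Set V) → ℝ) hS
    rw [Set.Finite.coe_toFinset] at this
    rw [this, Set.ncard_eq_toFinset_card A hA]
    simp
  rw [key h1 _ Finset.subset_union_left, key h2 _ Finset.subset_union_right]

/-- The translates contained in `[x,y]_H` that `z` splits. -/
def splitTranslates (X : SimpleGraph V) (Γ : Type*) [SMul Γ V] {l : ℕ}
    (s : Fin l → Set V) (x y z : V) : Set (Fin l → Set V) :=
  {t | t ∈ translatesIn X Γ s x y ∧ (∃ i, z ∈ t i) ∧ ∃ i, z ∉ t i}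

theorem splitTranslates_ncard_le {T : SimpleGraph V} (hT : T.IsTree) {Γ : Type*} [SMul Γ V]
    {l : ℕ} (hl : 0 < l) {s : Fin l → Set V} (hs : ∀ γ : Γ, IsHSegment T l (segSMul γ s))
    (x y z : V) : (splitTranslates T Γ s x y z).ncard ≤ l := by
  have : Nonempty (Fin l) := ⟨⟨0, hl⟩⟩
  have hex : ∀ t ∈ splitTranslates T Γ s x y z,
      ∃ i j : Fin l, (j : ℕ) = (i : ℕ) + 1 ∧ z ∈ t i ∧ z ∉ t j := by
    rintro t ⟨⟨⟨γ, rfl⟩, -⟩, hin, hout⟩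
    exact exists_splitting (hs γ) hin hout
  choose! i j hij hi hj using hex
  have hinj : Set.InjOn (fun t => (i t : ℕ)) (splitTranslates T Γ s x y z) := by
    intro t ht t' ht' he
    have hi_eq : i t = i t' := Fin.ext he
    have hj_eq : j t = j t' := Fin.ext (by rw [hij t ht, hij t' ht', hi_eq])
    have hsegt : IsHSegment T l t := by
      obtain ⟨γ, hγ⟩ := ht.1.1
      exact hγ ▸ hs γ
    have hsegt' : IsHSegment T l t' := by
      obtain ⟨γ, hγ⟩ := ht'.1.1
      exact hγ ▸ hs γ
    exact eq_of_splitting hT hsegt hsegt' ht.1.2 ht'.1.2 (i t) (j t) (hij t ht) (hi t ht)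
      (hj t ht) (hi_eq ▸ hi t' ht') (hj_eq ▸ hj t' ht')
  calc (splitTranslates T Γ s x y z).ncard
      ≤ ((Finset.range l : Finset ℕ) : Set ℕ).ncard :=
        Set.ncard_le_ncard_of_injOn _ (fun t _ => by simp) hinj (Finset.finite_toSet _)
    _ = l := by simp

theorem d1_segSign (X : SimpleGraph V) (Γ : Type*) [SMul Γ V] {l : ℕ} (hl : 0 < l)
    (s : Fin l → Set V) (x y z : V) (t : Fin l → Set V) :
    segSign X Γ s y z t - segSign X Γ s x z t + segSign X Γ s x y t =
      (splitTranslates X Γ s x y z).indicator 1 t + (splitTranslates X Γ s y z x).indicator 1 t +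
      (splitTranslates X Γ s z x y).indicator 1 t - (splitTranslates X Γ s y x z).indicator 1 t -
      (splitTranslates X Γ s z y x).indicator 1 t -
      (splitTranslates X Γ s x z y).indicator 1 t := by
  classical
  have hne : ∀ v, (∀ i, v ∈ t i) → (∀ i, v ∉ t i) → False :=
    fun v h h' => h' ⟨0, hl⟩ (h ⟨0, hl⟩)
  have h1 : ∀ u v, t ∈ translatesIn X Γ s u v ↔
      ((∃ γ : Γ, t = segSMul γ s) ∧ ∀ i, IsHalfspace X (t i)) ∧
        (∀ i, v ∈ t i) ∧ ∀ i, u ∉ t i := by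
    intro u v
    simp only [translatesIn, SegIn, sepH, Set.mem_ofPred_eq, forall_and]
    tauto
  have h2 : ∀ u v w, t ∈ splitTranslates X Γ s u v w ↔
      (((∃ γ : Γ, t = segSMul γ s) ∧ ∀ i, IsHalfspace X (t i)) ∧
        (∀ i, v ∈ t i) ∧ ∀ i, u ∉ t i) ∧ ¬ (∀ i, w ∉ t i) ∧ ¬ ∀ i, w ∈ t i := by
    intro u v w
    rw [← h1]
    simp only [splitTranslates, Set.mem_ofPred_eq, not_forall, not_not]
  obtain ⟨e, he⟩ : ∃ e : Prop → ℝ, ∀ A : Set (Fin l → Set V), A.indicator 1 t = e (t ∈ A) :=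
    ⟨fun p => if p then 1 else 0, fun A => Set.indicator_apply A 1 t⟩
  have e1 : e True = 1 := by simpa using (he Set.univ).symm
  have e0 : e False = 0 := by simpa using (he ∅).symm
  simp only [segSign, he, h1, h2]
  have hx := hne x
  have hy := hne y
  have hz := hne z
  clear h1 h2 hne he
  generalize ((∃ γ : Γ, t = segSMul γ s) ∧ ∀ i, IsHalfspace X (t i)) = Q
  generalize (∀ i, x ∈ t i) = A1 at *
  generalize (∀ i, y ∈ t i) = A2 at *
  generalize (∀ i, z ∈ t i) = A3 at *
  generalize (∀ i, x ∉ t i) = N1 at *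
  generalize (∀ i, y ∉ t i) = N2 at *
  generalize (∀ i, z ∉ t i) = N3 at *
  by_cases Q
  · by_cases A1 <;> by_cases A2 <;> by_cases A3 <;> by_cases N1 <;> by_cases N2 <;>
      by_cases N3 <;> simp_all
  · simp_all

theorem abs_sum_indicator_le {ι : Type*} (S : Finset ι) (A : Set ι) (hA : A.Finite) {c : ι → ℝ}
    {C : ℝ} (hC : 0 ≤ C) (hc : ∀ t, |c t| ≤ C) {l : ℕ} (hl : A.ncard ≤ l) :
    |∑ t ∈ S, c t * A.indicator 1 t| ≤ C * l := by
  classical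
  calc |∑ t ∈ S, c t * A.indicator 1 t| ≤ ∑ t ∈ S, |c t * A.indicator 1 t| :=
        Finset.abs_sum_le_sum_abs _ _
    _ ≤ ∑ t ∈ S, C * A.indicator 1 t := by
        refine Finset.sum_le_sum fun t _ => ?_
        rw [abs_mul]
        by_cases h : t ∈ A <;> simp [h, hc t]
    _ = C * ∑ t ∈ S, A.indicator 1 t := by rw [Finset.mul_sum]
    _ ≤ C * l := by
        refine mul_le_mul_of_nonneg_left ?_ hC
        calc ∑ t ∈ S, A.indicator (1 : ι → ℝ) t
            ≤ ∑ t ∈ S ∪ hA.toFinset, A.indicator (1 : ι → ℝ) t :=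
              Finset.sum_le_sum_of_subset_of_nonneg Finset.subset_union_left
                fun t _ _ => Set.indicator_nonneg (fun _ _ => zero_le_one) t
          _ = A.ncard := by
              have := Finset.sum_indicator_subset (1 : ι → ℝ)
                (Finset.subset_union_right (s₁ := S) (s₂ := hA.toFinset))
              rw [Set.Finite.coe_toFinset] at this
              rw [this, Set.ncard_eq_toFinset_card A hA]
              simp
          _ ≤ l := by exact_mod_cast hl

/-- The coboundary of a weighted median quasimorphism is bounded in terms of the weights. -/
theorem abs_d1_weightedFs_le {T : SimpleGraph V} (hT : T.IsTree) {Γ : Type*} [SMul Γ V]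
    {l : ℕ} (hl : 0 < l) {s : Fin l → Set V} (hs : ∀ γ : Γ, IsHSegment T l (segSMul γ s))
    {w : (Fin l → Set V) → ℝ} {C : ℝ} (hC : 0 ≤ C) (hw : ∀ t, |w t| ≤ C) (x y z : V) :
    |d1 (weightedFs T Γ s w) x y z| ≤ 6 * (C * l) := by
  classical
  let F : V → V → Finset (Fin l → Set V) := fun u v => (translatesIn_finite hT Γ s u v).toFinset
  let S := F x y ∪ F y x ∪ F y z ∪ F z y ∪ F x z ∪ F z x
  have hsum : ∀ u v, F u v ⊆ S → F v u ⊆ S →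
      weightedFs T Γ s w u v = ∑ t ∈ S, w t * segSign T Γ s u v t := fun u v h1 h2 =>
    weightedFs_eq_sum T Γ s w (fun t ht => h1 (by simpa [F] using ht))
      fun t ht => h2 (by simpa [F] using ht)
  have hb : ∀ a b c, |∑ t ∈ S, w t * (splitTranslates T Γ s a b c).indicator 1 t| ≤ C * l :=
    fun a b c => abs_sum_indicator_le S _
      ((translatesIn_finite hT Γ s a b).subset fun t ht => ht.1) hC hw
      (splitTranslates_ncard_le hT hl hs a b c)
  have hd : d1 (weightedFs T Γ s w) x y z =
      ∑ t ∈ S, w t * (splitTranslates T Γ s x y z).indicator 1 t +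
      ∑ t ∈ S, w t * (splitTranslates T Γ s y z x).indicator 1 t +
      ∑ t ∈ S, w t * (splitTranslates T Γ s z x y).indicator 1 t -
      ∑ t ∈ S, w t * (splitTranslates T Γ s y x z).indicator 1 t -
      ∑ t ∈ S, w t * (splitTranslates T Γ s z y x).indicator 1 t -
      ∑ t ∈ S, w t * (splitTranslates T Γ s x z y).indicator 1 t := by
    unfold d1
    have hS : ∀ A, A ∈ [F x y, F y x, F y z, F z y, F x z, F z x] → A ⊆ S := by
      intro A hA t ht
      simp only [List.mem_cons, List.not_mem_nil, or_false] at hA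
      simp only [S, Finset.mem_union]
      rcases hA with rfl | rfl | rfl | rfl | rfl | rfl <;> simp only [ht, true_or, or_true]
    rw [hsum y z (hS _ (by simp)) (hS _ (by simp)), hsum x z (hS _ (by simp)) (hS _ (by simp)),
      hsum x y (hS _ (by simp)) (hS _ (by simp))]
    simp only [← Finset.sum_sub_distrib, ← Finset.sum_add_distrib]
    refine Finset.sum_congr rfl fun t _ => ?_
    linear_combination w t * d1_segSign T Γ hl s x y z t
  rw [hd]
  have b1 := abs_le.1 (hb x y z)
  have b2 := abs_le.1 (hb y z x)
  have b3 := abs_le.1 (hb z x y)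
  have b4 := abs_le.1 (hb y x z)
  have b5 := abs_le.1 (hb z y x)
  have b6 := abs_le.1 (hb x z y)
  exact abs_le.2 ⟨by linarith, by linarith⟩

section Action

variable {Γ : Type*} [Group Γ] [MulAction Γ V]

theorem dist_smul {T : SimpleGraph V} (hT : T.Connected) (hact : ActsOn Γ T) (γ : Γ) (a b : V) :
    T.dist (γ • a) (γ • b) = T.dist a b := by
  have key : ∀ (γ : Γ) (a b : V), T.dist (γ • a) (γ • b) ≤ T.dist a b := by
    intro γ a b
    obtain ⟨p, hp⟩ := hT.exists_walk_length_eq_dist a b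
    let f : T →g T := ⟨fun v => γ • v, fun h => hact γ _ _ h⟩
    rw [← hp, ← SimpleGraph.Walk.length_map f p]
    exact SimpleGraph.dist_le (p.map f)
  refine le_antisymm (key γ a b) ?_
  simpa using key γ⁻¹ (γ • a) (γ • b)

theorem image_smul_halfspace {T : SimpleGraph V} (hT : T.Connected) (hact : ActsOn Γ T) (γ : Γ)
    (a b : V) : (γ • ·) '' {v | T.dist v a < T.dist v b} =
      {v | T.dist v (γ • a) < T.dist v (γ • b)} := by
  ext v
  constructor
  · rintro ⟨u, hu, rfl⟩
    simpa [dist_smul hT hact] using hu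
  · intro hv
    refine ⟨γ⁻¹ • v, ?_, by simp⟩
    have h : ∀ c, T.dist (γ⁻¹ • v) c = T.dist v (γ • c) := fun c => by
      rw [← dist_smul hT hact γ, smul_inv_smul]
    simpa [h] using hv

theorem IsHalfspace.image_smul {T : SimpleGraph V} (hT : T.Connected) (hact : ActsOn Γ T) (γ : Γ)
    {h : Set V} (hh : IsHalfspace T h) : IsHalfspace T ((γ • ·) '' h) := by
  obtain ⟨a, b, hab, rfl⟩ := hh
  exact ⟨γ • a, γ • b, hact γ a b hab, image_smul_halfspace hT hact γ a b⟩

theorem image_inv_smul_image_smul (γ : Γ) (h : Set V) :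
    (γ⁻¹ • ·) '' ((γ • ·) '' h) = h := by
  simp [Set.image_image]

theorem image_smul_image_inv_smul (γ : Γ) (h : Set V) :
    (γ • ·) '' ((γ⁻¹ • ·) '' h) = h := by
  simp [Set.image_image]

theorem isHalfspace_image_smul_iff {T : SimpleGraph V} (hT : T.Connected) (hact : ActsOn Γ T)
    (γ : Γ) {h : Set V} : IsHalfspace T ((γ • ·) '' h) ↔ IsHalfspace T h :=
  ⟨fun hh => image_inv_smul_image_smul γ h ▸ hh.image_smul hT hact γ⁻¹,
    fun hh => hh.image_smul hT hact γ⟩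

/-- A group element acts on tuples of halfspaces by a permutation. -/
def segSMulEquiv (Γ : Type*) [Group Γ] [MulAction Γ V] (γ : Γ) (l : ℕ) :
    (Fin l → Set V) ≃ (Fin l → Set V) where
  toFun := segSMul γ
  invFun := segSMul γ⁻¹
  left_inv t := funext fun i => image_inv_smul_image_smul γ (t i)
  right_inv t := funext fun i => image_smul_image_inv_smul γ (t i)

theorem image_smul_ssubset_iff (γ : Γ) {h k : Set V} :
    (γ • ·) '' k ⊂ (γ • ·) '' h ↔ k ⊂ h := by
  simp only [ssubset_iff_subset_not_subset, Set.image_subset_image_iff (MulAction.injective γ)]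

theorem IsHSegment.segSMul {T : SimpleGraph V} (hT : T.Connected) (hact : ActsOn Γ T) {l : ℕ}
    {s : Fin l → Set V} (hs : IsHSegment T l s) (γ : Γ) : IsHSegment T l (segSMul γ s) := by
  refine ⟨fun i => (hs.1 i).image_smul hT hact γ, fun i j hij => ?_⟩
  obtain ⟨h1, h2⟩ := hs.2 i j hij
  refine ⟨(image_smul_ssubset_iff γ).2 h1, ?_⟩
  rintro ⟨h', hh', h3, h4⟩
  refine h2 ⟨(γ⁻¹ • ·) '' h', hh'.image_smul hT hact γ⁻¹, ?_, ?_⟩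
  · rw [← image_smul_ssubset_iff γ, image_smul_image_inv_smul]
    exact h3
  · rw [← image_smul_ssubset_iff γ, image_smul_image_inv_smul]
    exact h4

theorem segSMul_mem_translatesIn {T : SimpleGraph V} (hT : T.Connected) (hact : ActsOn Γ T)
    (γ : Γ) {l : ℕ} {s t : Fin l → Set V} {x y : V} :
    segSMul γ t ∈ translatesIn T Γ s (γ • x) (γ • y) ↔ t ∈ translatesIn T Γ s x y := by
  have hmem : ∀ (v : V) (h : Set V), γ • v ∈ (γ • ·) '' h ↔ v ∈ h := fun v h =>
    (MulAction.injective γ).mem_set_image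
  have htr : (∃ δ : Γ, segSMul γ t = segSMul δ s) ↔ ∃ δ : Γ, t = segSMul δ s := by
    constructor
    · rintro ⟨δ, hδ⟩
      refine ⟨γ⁻¹ * δ, funext fun i => ?_⟩
      rw [← image_inv_smul_image_smul γ (t i)]
      change (γ⁻¹ • ·) '' (segSMul γ t i) = _
      rw [hδ]
      simp [segSMul, Set.image_image, mul_smul]
    · rintro ⟨δ, rfl⟩
      exact ⟨γ * δ, funext fun i => by simp [segSMul, Set.image_image, mul_smul]⟩
  refine and_congr htr (forall_congr' fun i => ?_)
  exact and_congr (isHalfspace_image_smul_iff hT hact γ)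
    (and_congr (hmem y _) (not_congr (hmem x _)))

theorem weightedFs_smul {T : SimpleGraph V} (hT : T.Connected) (hact : ActsOn Γ T) (γ : Γ)
    {l : ℕ} (s : Fin l → Set V) {w w' : (Fin l → Set V) → ℝ}
    (hw : ∀ t, w' (segSMul γ t) = w t) (x y : V) :
    weightedFs T Γ s w' (γ • x) (γ • y) = weightedFs T Γ s w x y := by
  classical
  unfold weightedFs
  rw [← finsum_comp_equiv (segSMulEquiv Γ γ l)]
  refine finsum_congr fun t => ?_
  change w' (segSMul γ t) * segSign T Γ s (γ • x) (γ • y) (segSMul γ t) = _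
  rw [hw]
  simp only [segSign, Set.indicator_apply, segSMul_mem_translatesIn hT hact,
    Pi.one_apply]

open Classical in
/-- Evaluation of a cochain at the endpoint inside the first halfspace of a tuple. -/
noncomputable def endpointWeight (X : SimpleGraph V) {n l : ℕ} (hl : 0 < l)
    (κ : (Fin (n + 1) → V) → ℝ) (z : Fin n → V) (t : Fin l → Set V) : ℝ :=
  if h : IsHalfspace X (t ⟨0, hl⟩) then κ (Fin.cons h.choose z) else 0

theorem abs_endpointWeight_le (X : SimpleGraph V) {n l : ℕ} (hl : 0 < l)
    {κ : (Fin (n + 1) → V) → ℝ} {C : ℝ} (hC : 0 ≤ C) (hκ : ∀ x, |κ x| ≤ C) (z : Fin n → V)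
    (t : Fin l → Set V) : |endpointWeight X hl κ z t| ≤ C := by
  unfold endpointWeight
  split_ifs
  · exact hκ _
  · simpa using hC

theorem endpointWeight_smul {T : SimpleGraph V} (hT : T.IsTree) (hact : ActsOn Γ T) (γ : Γ)
    {n l : ℕ} (hl : 0 < l) {κ : (Fin (n + 1) → V) → ℝ} (hκ : IsInvariant Γ κ) (z : Fin n → V)
    (t : Fin l → Set V) :
    endpointWeight T hl κ (fun i => γ • z i) (segSMul γ t) = endpointWeight T hl κ z t := by
  have hC := hT.connected
  by_cases h : IsHalfspace T (t ⟨0, hl⟩)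
  · have h' : IsHalfspace T (segSMul γ t ⟨0, hl⟩) := h.image_smul hC hact γ
    have he : h'.choose = γ • h.choose := by
      obtain ⟨b, hab, hb⟩ := h.choose_spec
      obtain ⟨d, hcd, hd⟩ := h'.choose_spec
      have hd' : (γ • ·) '' t ⟨0, hl⟩ = _ := hd
      rw [hb, image_smul_halfspace hC hact] at hd'
      have h1 : γ • h.choose ∈ {v | T.dist v h'.choose < T.dist v d} := by
        rw [← hd']
        simp [SimpleGraph.dist_eq_one_iff_adj.2 (hact γ _ _ hab)]
      have h2 : γ • b ∉ {v | T.dist v h'.choose < T.dist v d} := by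
        rw [← hd']
        simp
      exact (eq_of_mem_of_notMem hT hcd (hact γ _ _ hab) h1 h2).1.symm
    rw [endpointWeight, endpointWeight, dif_pos h, dif_pos h', he, ← hκ γ (Fin.cons h.choose z)]
    congr 1
    funext i
    refine Fin.cases ?_ (fun i => ?_) i <;> simp
  · have h' : ¬ IsHalfspace T (segSMul γ t ⟨0, hl⟩) := fun h' =>
      h ((isHalfspace_image_smul_iff hC hact γ).1 h')
    rw [endpointWeight, endpointWeight, dif_neg h, dif_neg h']

end Action

/-- The coboundary of the endpoint-weighted cochain trades the cup product for a weighted median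
quasimorphism. -/
theorem augCob_endpointWeight {T : SimpleGraph V} (hT : T.IsTree) {Γ : Type*} [Group Γ]
    [MulAction Γ V] {k l : ℕ} (s : Fin l → Set V) (hl : 0 < l) {κ : (Fin (k + 2) → V) → ℝ}
    (hκ : ∀ x, augCob κ x = 0) (a b c : V)
    (y : Fin k → V) :
    augCob (fun x : Fin (k + 2) → V =>
        weightedFs T Γ s (endpointWeight T hl κ (Fin.tail x)) (x 0) (x 1))
        (Fin.cons a (Fin.cons b (Fin.cons c y))) =
      d1 (weightedFs T Γ s (endpointWeight T hl κ (Fin.cons c y))) a b c -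
        fs T Γ s a b * κ (Fin.cons b (Fin.cons c y)) := by
  have h : augCob (fun z : Fin k → V =>
      weightedFs T Γ s (endpointWeight T hl κ (Fin.cons b z)) a b) (Fin.cons c y) =
        weightedFs T Γ s (endpointWeight T hl κ (Fin.cons c y)) a b -
          fs T Γ s a b * κ (Fin.cons b (Fin.cons c y)) := by
    obtain ⟨S, hS⟩ := exists_weightedFs_eq_sum hT Γ s a b
    rw [fs_eq_weightedFs hT]
    simp only [hS]
    rw [augCob_sum, Finset.sum_mul, ← Finset.sum_sub_distrib]
    refine Finset.sum_congr rfl fun t _ => ?_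
    by_cases ht : IsHalfspace T (t ⟨0, hl⟩)
    · simp only [endpointWeight, dif_pos ht, mul_comm _ (segSign T Γ s a b t), augCob_const_mul,
        augCob_cons_of_cocycle hκ, Pi.one_apply]
      ring
    · have h0 : segSign T Γ s a b t = 0 := by
        unfold segSign
        rw [Set.indicator_of_notMem fun h => ht (h.2 _).1,
          Set.indicator_of_notMem fun h => ht (h.2 _).1, sub_zero]
      simp [h0, augCob]
  rw [augCob_cons]
  simp only [Fin.cons_zero, Fin.cons_one, Fin.tail_cons]
  rw [augCob_cons]
  simp only [Fin.cons_zero, h]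
  unfold d1
  ring

/-- Theorem `thm:maintree`: for a group acting on a tree `T` by graph
automorphisms, an H-segment `s` and `n ≥ 1`, every bounded Γ-invariant cocycle `κ` on
`V^{n+1}` satisfies: `(δ¹f_s) ∪ κ` has a bounded Γ-invariant primitive, i.e.
`[δ¹f_s] ∪ ζ = 0` in degree-(n+2) Γ-equivariant bounded cohomology of `T`. -/
theorem statement5 {V : Type*} (T : SimpleGraph V) (hT : T.IsTree)
    (Γ : Type*) [Group Γ] [MulAction Γ V] (hact : ActsOn Γ T)
    (l : ℕ) (hl : 1 ≤ l) (s : Fin l → Set V) (hseg : IsHSegment T l s)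
    (n : ℕ) (hn : 1 ≤ n) (κ : (Fin (n + 1) → V) → ℝ)
    (hκb : IsBounded κ) (hκinv : IsInvariant Γ κ) (hκcoc : cob κ = 0) :
    ∃ β : (Fin (n + 2) → V) → ℝ, IsBounded β ∧ IsInvariant Γ β ∧
      ∀ x : Fin (n + 3) → V,
        cob β x =
          d1 (fs T Γ s) (x 0) (x 1) (x 2) *
            κ (fun i => x ⟨2 + (i : ℕ), by have := i.isLt; omega⟩) := by
  obtain ⟨k, rfl⟩ : ∃ k, n = k + 1 := ⟨n - 1, by omega⟩
  obtain ⟨C, hC⟩ := hκb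
  have hκ : ∀ x, augCob κ x = 0 := fun x => congrFun hκcoc x
  have hC0 : 0 ≤ C := (abs_nonneg _).trans (hC fun _ => hT.connected.nonempty.some)
  let L : (Fin (k + 3) → V) → ℝ := fun x => fs T Γ s (x 0) (x 1) * κ (Fin.tail x)
  let η : (Fin (k + 2) → V) → ℝ := fun x =>
    weightedFs T Γ s (endpointWeight T hl κ (Fin.tail x)) (x 0) (x 1)
  have hη : IsInvariant Γ η := fun γ x =>
    weightedFs_smul hT.connected hact γ s
      (fun t => endpointWeight_smul hT hact γ hl hκinv (Fin.tail x) t) (x 0) (x 1)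
  have hL : IsInvariant Γ L := by
    intro γ x
    simp only [L, fs_eq_weightedFs hT]
    rw [weightedFs_smul hT.connected hact γ s (w := 1) (fun _ => rfl)]
    exact congrArg _ (hκinv γ (Fin.tail x))
  refine ⟨fun x => L x + augCob η x, ⟨6 * (C * l), ?_⟩, ?_, ?_⟩
  · intro x
    obtain ⟨a, x, rfl⟩ := exists_eq_cons x
    obtain ⟨b, x, rfl⟩ := exists_eq_cons x
    obtain ⟨c, y, rfl⟩ := exists_eq_cons x
    have h := augCob_endpointWeight hT (Γ := Γ) s hl hκ a b c y
    have hLη : L (Fin.cons a (Fin.cons b (Fin.cons c y))) +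
        augCob η (Fin.cons a (Fin.cons b (Fin.cons c y))) =
          d1 (weightedFs T Γ s (endpointWeight T hl κ (Fin.cons c y))) a b c := by
      refine (congrArg (L (Fin.cons a (Fin.cons b (Fin.cons c y))) + ·) h).trans ?_
      simp only [L, Fin.cons_zero, Fin.cons_one, Fin.tail_cons]
      ring
    refine (congrArg abs hLη).trans_le ?_
    exact abs_d1_weightedFs_le hT hl (fun γ => hseg.segSMul hT.connected hact γ) hC0
      (abs_endpointWeight_le T hl hC0 hC (Fin.cons c y)) a b c
  · intro γ x
    exact congrArg₂ (· + ·) (hL γ x) (augCob_invariant hη γ x)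
  · intro x
    rw [cob_eq_augCob, augCob_add, augCob_augCob, add_zero]
    obtain ⟨a, x, rfl⟩ := exists_eq_cons x
    obtain ⟨b, x, rfl⟩ := exists_eq_cons x
    obtain ⟨c, y, rfl⟩ := exists_eq_cons x
    refine (augCob_cup hκ (fs T Γ s) a b c y).trans ?_
    refine congrArg₂ (· * ·) rfl (congrArg κ (funext fun i => ?_))
    have h : (⟨2 + (i : ℕ), by omega⟩ : Fin (k + 4)) = i.succ.succ := by
      ext
      simp
      omega
    rw [h, Fin.cons_succ, Fin.cons_succ]

end MedianQM
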